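/- arXiv:2012.08288 — 7 statements merged into one kernel-verified Lean document; each statement's English description precedes it below -/
import Mathlib

section
/- Let n, m be positive integers with m ≤ n, let ρ₀ and ρ₁ be density matrices of size 2ⁿ, and let O = X^{⊗m}. Then the following are equivalent: (a) for every unitary matrix U of size 2^m and every index i with 0 ≤ i ≤ n − m, Tr(ρ₀ · (I_{2^i} ⊗ (U† O U) ⊗ I_{2^{n−m−i}})) = Tr(ρ₁ · (I_{2^i} ⊗ (U† O U) ⊗ I_{2^{n−m−i}})); (b) for every complex matrix A of size 2^m and every index i with 0 ≤ i ≤ n − m, Tr(ρ₀ · (I_{2^i} ⊗ A ⊗ I_{2^{n−m−i}})) = Tr(ρ₁ · (I_{2^i} ⊗ A ⊗ I_{2^{n−m−i}})). (Condition (b) says exactly that the corresponding m-local reduced density matrices, i.e. partial traces onto each window of m consecutive qubits, of ρ₀ and ρ₁ coincide.) -/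
open Matrix Kronecker ComplexOrder

noncomputable def pauliX : Matrix (Fin 2) (Fin 2) ℂ := !![0, 1; 1, 0]

noncomputable def kronPow : (k : ℕ) → Matrix (Fin 2) (Fin 2) ℂ → Matrix (Fin (2 ^ k)) (Fin (2 ^ k)) ℂ
  | 0, _ => 1
  | k + 1, A =>
      Matrix.reindex (finProdFinEquiv.trans (finCongr (pow_succ 2 k).symm))
        (finProdFinEquiv.trans (finCongr (pow_succ 2 k).symm))
        (kronPow k A ⊗ₖ A)

def windowEquiv (n k i : ℕ) (h : i + k ≤ n) :
    (Fin (2 ^ i) × (Fin (2 ^ k) × Fin (2 ^ (n - k - i)))) ≃ Fin (2 ^ n) :=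
  ((Equiv.prodCongr (Equiv.refl (Fin (2 ^ i))) finProdFinEquiv).trans finProdFinEquiv).trans
    (finCongr (by rw [← pow_add, ← pow_add]; congr 1; omega))

noncomputable def windowEmbed (n k i : ℕ) (h : i + k ≤ n)
    (A : Matrix (Fin (2 ^ k)) (Fin (2 ^ k)) ℂ) : Matrix (Fin (2 ^ n)) (Fin (2 ^ n)) ℂ :=
  Matrix.reindex (windowEquiv n k i h) (windowEquiv n k i h)
    ((1 : Matrix (Fin (2 ^ i)) (Fin (2 ^ i)) ℂ) ⊗ₖ
      (A ⊗ₖ (1 : Matrix (Fin (2 ^ (n - k - i))) (Fin (2 ^ (n - k - i))) ℂ)))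

noncomputable def sigmoid (z : ℝ) : ℝ := 1 / (1 + Real.exp (-z))

noncomputable def shadowFeature (n k i : ℕ) (h : i + k ≤ n)
    (ρ : Matrix (Fin (2 ^ n)) (Fin (2 ^ n)) ℂ)
    (U : Matrix (Fin (2 ^ k)) (Fin (2 ^ k)) ℂ) : ℝ :=
  ((ρ * windowEmbed n k i h (Uᴴ * kronPow k pauliX * U)).trace).re

section UnitaryInvariant

variable {ι : Type*} [Fintype ι] [DecidableEq ι]

theorem unitary_one_add_smul_projection {P : Matrix ι ι ℂ} (hP : Pᴴ = P) (hPP : P * P = P) :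
    1 + (Complex.I - 1) • P ∈ Matrix.unitaryGroup ι ℂ := by
  have hs : star (1 + (Complex.I - 1) • P) = 1 + (-Complex.I - 1) • P := by
    rw [star_eq_conjTranspose]
    simp [hP]
  rw [Matrix.mem_unitaryGroup_iff, hs]
  simp only [mul_add, add_mul, mul_one, one_mul, smul_mul_assoc, mul_smul_comm, hPP]
  match_scalars
  · ring
  · linear_combination -Complex.I_sq

/-- A unitarily invariant subspace is stable under commutators with orthogonal projections. -/
theorem commutator_projection_mem {W : Submodule ℂ (Matrix ι ι ℂ)}
    (hW : ∀ U ∈ Matrix.unitaryGroup ι ℂ, ∀ M ∈ W, Uᴴ * M * U ∈ W)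
    {P : Matrix ι ι ℂ} (hP : Pᴴ = P) (hPP : P * P = P) {M : Matrix ι ι ℂ} (hM : M ∈ W) :
    M * P - P * M ∈ W := by
  have hU := unitary_one_add_smul_projection hP hPP
  have h₁ := hW _ hU M hM
  have h₂ := hW _ (Unitary.star_mem hU) M hM
  have hs : (1 + (Complex.I - 1) • P)ᴴ = 1 + (-Complex.I - 1) • P := by simp [hP]
  rw [star_eq_conjTranspose, conjTranspose_conjTranspose] at h₂
  rw [hs] at h₁ h₂
  have h := W.smul_mem (-Complex.I / 2) (W.sub_mem h₁ h₂)
  convert h using 1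
  simp only [mul_add, add_mul, mul_one, one_mul, smul_mul_assoc, mul_smul_comm, smul_add,
    smul_sub, smul_smul]
  match_scalars <;> ring_nf <;> simp [Complex.I_sq]

theorem commutator_single_mem {W : Submodule ℂ (Matrix ι ι ℂ)}
    (hW : ∀ U ∈ Matrix.unitaryGroup ι ℂ, ∀ M ∈ W, Uᴴ * M * U ∈ W)
    (x y : ι) {M : Matrix ι ι ℂ} (hM : M ∈ W) :
    M * single x y 1 - single x y 1 * M ∈ W := by
  obtain rfl | hxy := eq_or_ne x y
  · exact commutator_projection_mem hW (by simp) (by simp) hM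
  have key (c : ℂ) (hc : star c * c = 1) :
      M * ((1 / 2 : ℂ) • (single x x 1 + single y y 1 + c • single x y 1 + star c • single y x 1)) -
        ((1 / 2 : ℂ) • (single x x 1 + single y y 1 + c • single x y 1 +
          star c • single y x 1)) * M ∈ W := by
    refine commutator_projection_mem hW ?_ ?_ hM
    · simp
      abel
    · simp only [mul_add, add_mul, smul_mul_assoc, mul_smul_comm, smul_add, smul_smul,
        single_mul_single_same, single_mul_single_of_ne _ _ _ _ hxy,
        single_mul_single_of_ne _ _ _ _ hxy.symm, mul_one]
      match_scalars <;> first | ring1 | linear_combination (1 / 4) * hc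
  have h₁ := key 1 (by simp)
  have h₂ := key (-1) (by simp)
  have h₃ := key Complex.I (by simp)
  have h₄ := key (-Complex.I) (by simp)
  have h := W.sub_mem (W.smul_mem (1 / 2) (W.sub_mem h₁ h₂))
    (W.smul_mem (Complex.I / 2) (W.sub_mem h₃ h₄))
  convert h using 1
  simp only [mul_add, add_mul, smul_mul_assoc, mul_smul_comm, smul_add,
    smul_sub, smul_smul, star_one, star_neg, Complex.star_def, Complex.conj_I]
  match_scalars <;> ring_nf <;> simp [Complex.I_sq] <;> ring_nf

/-- A unitarily invariant subspace containing the identity and a matrix with a nonzero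
off-diagonal entry is the whole matrix space. -/
theorem eq_top_of_unitary_invariant {W : Submodule ℂ (Matrix ι ι ℂ)}
    (hW : ∀ U ∈ Matrix.unitaryGroup ι ℂ, ∀ M ∈ W, Uᴴ * M * U ∈ W)
    (hone : 1 ∈ W) {M : Matrix ι ι ℂ} (hM : M ∈ W) {x y : ι} (hxy : x ≠ y) (hMxy : M x y ≠ 0) :
    W = ⊤ := by
  have hC := @commutator_single_mem ι _ _ W hW
  have hxyW : single x y 1 ∈ W := by
    have h₁ := hC y y (hC x x hM)
    have h₂ := hC y y h₁
    have h := W.smul_mem (-(2 * M x y)⁻¹) (W.add_mem h₁ h₂)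
    have hz (i j : ι) : single i i (1 : ℂ) * M * single j j 1 = M i j • single i j 1 := by
      rw [single_mul_mul_single]
      simp
    have hyx : single y y (1 : ℂ) * single x x 1 = 0 := single_mul_single_of_ne _ _ _ _ hxy.symm _
    have hxy' : single x x (1 : ℂ) * single y y 1 = 0 := single_mul_single_of_ne _ _ _ _ hxy _
    have e₁ : (M * single x x 1 - single x x 1 * M) * single y y 1 -
        single y y 1 * (M * single x x 1 - single x x 1 * M) =
        -(M x y • single x y 1) - M y x • single y x 1 := by
      simp only [mul_sub, sub_mul, ← mul_assoc, hz, hyx, zero_mul]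
      simp only [mul_assoc, hxy', mul_zero]
      abel
    rw [e₁] at h
    convert h using 1
    simp only [mul_sub, sub_mul, neg_mul, mul_neg, smul_mul_assoc, mul_smul_comm,
      single_mul_single_same, single_mul_single_of_ne _ _ _ _ hxy,
      single_mul_single_of_ne _ _ _ _ hxy.symm, mul_one]
    match_scalars <;> field_simp <;> ring
  have hrow {a b : ι} (c : ι) (hca : c ≠ a) (h : single a b 1 ∈ W) : single a c 1 ∈ W := by
    have h' := hC b c h
    rwa [single_mul_single_same, single_mul_single_of_ne _ _ _ _ hca, mul_one, sub_zero] at h'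
  have hcol {a b : ι} (c : ι) (hcb : b ≠ c) (h : single a b 1 ∈ W) : single c b 1 ∈ W := by
    have h' := W.neg_mem (hC c a h)
    rwa [single_mul_single_same, single_mul_single_of_ne _ _ _ _ hcb, mul_one, zero_sub,
      neg_neg] at h'
  have hoff {a b : ι} (hab : a ≠ b) : single a b 1 ∈ W := by
    by_cases hay : a = y
    · by_cases hbx : b = x
      · rw [hay, hbx]
        have h := W.smul_mem (-(1 / 2)) (hC y x (hC y x hxyW))
        convert h using 1
        simp only [mul_sub, sub_mul, single_mul_single_same, single_mul_single_of_ne _ _ _ _ hxy,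
          mul_one]
        module
      · exact hcol _ hab.symm (hrow _ hbx hxyW)
    · exact hrow _ hab.symm (hcol _ (Ne.symm hay) hxyW)
  have hdiff (a b : ι) : single a a (1 : ℂ) - single b b 1 ∈ W := by
    obtain rfl | hab := eq_or_ne a b
    · simp
    · simpa using hC b a (hoff hab)
  have hdiag (a : ι) : single a a (1 : ℂ) ∈ W := by
    have h := W.add_mem hone (W.sum_mem fun b (_ : b ∈ Finset.univ) => hdiff a b)
    rw [Finset.sum_sub_distrib, sum_single_one, add_sub_cancel, Finset.sum_const,
      ← Nat.cast_smul_eq_nsmul ℂ] at h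
    refine (W.smul_mem_iff ?_).1 h
    exact Nat.cast_ne_zero.2 (Finset.card_ne_zero_of_mem (Finset.mem_univ a))
  rw [eq_top_iff]
  intro A _
  rw [matrix_eq_sum_single A]
  refine W.sum_mem fun a _ => W.sum_mem fun b _ => ?_
  rw [show single a b (A a b) = A a b • single a b 1 by simp]
  refine W.smul_mem _ ?_
  obtain rfl | hab := eq_or_ne a b
  · exact hdiag a
  · exact hoff hab

theorem eq_zero_of_unitary_orbit {f : Matrix ι ι ℂ →ₗ[ℂ] ℂ} (hone : f 1 = 0)
    {M : Matrix ι ι ℂ} {x y : ι} (hxy : x ≠ y) (hMxy : M x y ≠ 0)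
    (hM : ∀ U ∈ Matrix.unitaryGroup ι ℂ, f (Uᴴ * M * U) = 0) : f = 0 := by
  let W : Submodule ℂ (Matrix ι ι ℂ) :=
    { carrier := {A | ∀ U ∈ Matrix.unitaryGroup ι ℂ, f (Uᴴ * A * U) = 0}
      add_mem' := fun {A B} hA hB U hU => by simp [mul_add, add_mul, hA U hU, hB U hU]
      zero_mem' := fun U _ => by simp
      smul_mem' := fun c A hA U hU => by simp [hA U hU] }
  have hW : W = ⊤ := by
    refine eq_top_of_unitary_invariant (fun U hU A hA V hV => ?_) (fun U hU => ?_)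
      (show M ∈ W from hM) hxy hMxy
    · have h := hA (U * V) (mul_mem hU hV)
      rwa [conjTranspose_mul, show Vᴴ * Uᴴ * A * (U * V) = Vᴴ * (Uᴴ * A * U) * V by
        simp only [mul_assoc]] at h
    · rw [mul_one, ← star_eq_conjTranspose, Matrix.mem_unitaryGroup_iff'.1 hU, hone]
  ext A
  have hA : A ∈ W := hW ▸ Submodule.mem_top
  simpa using hA 1 (one_mem _)

end UnitaryInvariant

theorem exists_kronPow_pauliX_ne_zero (k : ℕ) : ∃ x y, kronPow k pauliX x y ≠ 0 := by
  induction k with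
  | zero => exact ⟨0, 0, by simp [kronPow]⟩
  | succ k ih =>
    obtain ⟨x, y, h⟩ := ih
    let e := finProdFinEquiv.trans (finCongr (pow_succ 2 k).symm)
    refine ⟨e (x, 0), e (y, 1), ?_⟩
    simpa [kronPow, e, pauliX] using h

theorem exists_kronPow_pauliX_off_diagonal {k : ℕ} (hk : 0 < k) :
    ∃ x y, x ≠ y ∧ kronPow k pauliX x y ≠ 0 := by
  obtain ⟨k, rfl⟩ := Nat.exists_eq_succ_of_ne_zero hk.ne'
  obtain ⟨x, y, h⟩ := exists_kronPow_pauliX_ne_zero k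
  let e := finProdFinEquiv.trans (finCongr (pow_succ 2 k).symm)
  refine ⟨e (x, 0), e (y, 1), fun h' => ?_, ?_⟩
  · simpa using congrArg Prod.snd (e.injective h')
  · simpa [kronPow, e, pauliX] using h

theorem windowEmbed_one (n k i : ℕ) (h : i + k ≤ n) : windowEmbed n k i h 1 = 1 := by
  simp [windowEmbed]

theorem windowEmbed_add (n k i : ℕ) (h : i + k ≤ n)
    (A B : Matrix (Fin (2 ^ k)) (Fin (2 ^ k)) ℂ) :
    windowEmbed n k i h (A + B) = windowEmbed n k i h A + windowEmbed n k i h B := by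
  simp only [windowEmbed, add_kronecker, kronecker_add]
  rfl

theorem windowEmbed_smul (n k i : ℕ) (h : i + k ≤ n) (c : ℂ)
    (A : Matrix (Fin (2 ^ k)) (Fin (2 ^ k)) ℂ) :
    windowEmbed n k i h (c • A) = c • windowEmbed n k i h A := by
  simp only [windowEmbed, smul_kronecker, kronecker_smul]
  rfl

theorem stmt_1 (n m : ℕ) (hn : 0 < n) (hm : 0 < m) (hmn : m ≤ n)
    (ρ₀ ρ₁ : Matrix (Fin (2 ^ n)) (Fin (2 ^ n)) ℂ)
    (h₀ : ρ₀.PosSemidef) (h₀t : ρ₀.trace = 1)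
    (h₁ : ρ₁.PosSemidef) (h₁t : ρ₁.trace = 1) :
    (∀ U ∈ Matrix.unitaryGroup (Fin (2 ^ m)) ℂ, ∀ (i : ℕ) (h : i + m ≤ n),
        (ρ₀ * windowEmbed n m i h (Uᴴ * kronPow m pauliX * U)).trace =
        (ρ₁ * windowEmbed n m i h (Uᴴ * kronPow m pauliX * U)).trace) ↔
    (∀ (A : Matrix (Fin (2 ^ m)) (Fin (2 ^ m)) ℂ) (i : ℕ) (h : i + m ≤ n),
        (ρ₀ * windowEmbed n m i h A).trace = (ρ₁ * windowEmbed n m i h A).trace) := by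
  refine ⟨fun H A i h => ?_, fun H U _ i h => H _ i h⟩
  obtain ⟨x, y, hxy, hO⟩ := exists_kronPow_pauliX_off_diagonal hm
  let f : Matrix (Fin (2 ^ m)) (Fin (2 ^ m)) ℂ →ₗ[ℂ] ℂ :=
    { toFun := fun A => ((ρ₀ - ρ₁) * windowEmbed n m i h A).trace
      map_add' := fun A B => by rw [windowEmbed_add, mul_add, trace_add]
      map_smul' := fun c A => by rw [windowEmbed_smul, mul_smul_comm, trace_smul]; rfl }
  have hf (A) : f A = (ρ₀ * windowEmbed n m i h A).trace -
      (ρ₁ * windowEmbed n m i h A).trace := by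
    rw [← trace_sub, ← sub_mul]
    rfl
  have hf0 : f = 0 := by
    refine eq_zero_of_unitary_orbit ?_ hxy hO fun U hU => ?_
    · rw [hf, windowEmbed_one, mul_one, mul_one, h₀t, h₁t, sub_self]
    · rw [hf, H U hU i h, sub_self]
  rw [← sub_eq_zero, ← hf, hf0, LinearMap.zero_apply]
end

section
/- Let d ≥ 2 and let μ be the normalized Haar probability measure on the unitary group U(d) of d × d complex unitary matrices. Then for all complex d × d matrices A, B, C, D, ∫_{U(d)} Tr(U A U† B U C U† D) dμ(U) = [Tr(A)Tr(C)Tr(BD) + Tr(AC)Tr(B)Tr(D)]/(d² − 1) − [Tr(AC)Tr(BD) + Tr(A)Tr(B)Tr(C)Tr(D)]/(d(d² − 1)). -/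
open Matrix MeasureTheory

open scoped Kronecker

section Algebra

variable {n : Type*} [Fintype n] [DecidableEq n]

instance unitaryGroup_compactSpace : CompactSpace (unitaryGroup n ℂ) := by
  suffices h : IsCompact (unitaryGroup n ℂ : Set (Matrix n n ℂ)) from
    isCompact_iff_compactSpace.mp h
  have hK : IsCompact (Set.univ.pi fun _ : n => Set.univ.pi fun _ : n =>
      Metric.closedBall (0 : ℂ) 1) :=
    isCompact_univ_pi fun _ => isCompact_univ_pi fun _ => isCompact_closedBall _ _
  refine IsCompact.of_isClosed_subset (X := Matrix n n ℂ) hK isClosed_unitary ?_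
  intro U hU i _ j _
  simpa using entry_norm_bound_of_unitary hU i j

open scoped Norms.Operator in
theorem hasDerivAt_exp_smul_apply (H : Matrix n n ℂ) (i j : n) :
    HasDerivAt (fun t : ℝ => NormedSpace.exp (t • H) i j) (H i j) 0 := by
  have hd := hasDerivAt_exp_smul_const (𝕂 := ℝ) H 0
  rw [zero_smul, NormedSpace.exp_zero, one_mul] at hd
  exact ((entryLinearMap ℝ ℂ i j).toContinuousLinearMap).hasFDerivAt.comp_hasDerivAt 0 hd

theorem exp_mem_unitaryGroup {H : Matrix n n ℂ} (hH : H ∈ skewAdjoint (Matrix n n ℂ)) :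
    NormedSpace.exp H ∈ unitaryGroup n ℂ := by
  have hH' : Hᴴ = -H := skewAdjoint.mem_iff.mp hH
  rw [mem_unitaryGroup_iff, star_eq_conjTranspose, ← exp_conjTranspose, hH',
    ← exp_add_of_commute _ _ (Commute.refl H).neg_right, add_neg_cancel, NormedSpace.exp_zero]

/-- Differentiating at the identity: a matrix commuting with `V ⊗ V` for every unitary `V`
commutes with `H ⊗ 1 + 1 ⊗ H` for skew-adjoint `H`. -/
theorem commute_kronecker_of_mem_skewAdjoint {T : Matrix (n × n) (n × n) ℂ}
    (hT : ∀ V ∈ unitaryGroup n ℂ, Commute T (V ⊗ₖ V))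
    {H : Matrix n n ℂ} (hH : H ∈ skewAdjoint (Matrix n n ℂ)) :
    Commute T (H ⊗ₖ (1 : Matrix n n ℂ) + (1 : Matrix n n ℂ) ⊗ₖ H) := by
  set E : ℝ → Matrix n n ℂ := fun t => NormedSpace.exp (t • H) with hE
  set L : Matrix (n × n) (n × n) ℂ := H ⊗ₖ (1 : Matrix n n ℂ) + (1 : Matrix n n ℂ) ⊗ₖ H with hL
  have hkron (p q : n × n) : HasDerivAt (fun t => (E t ⊗ₖ E t) p q) (L p q) 0 := by
    simpa [hE, hL, kroneckerMap_apply] using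
      (hasDerivAt_exp_smul_apply H p.1 q.1).fun_mul (hasDerivAt_exp_smul_apply H p.2 q.2)
  ext p q
  have hl : HasDerivAt (fun t => (T * (E t ⊗ₖ E t)) p q) ((T * L) p q) 0 := by
    simp only [mul_apply]
    exact HasDerivAt.fun_sum fun r _ => (hkron r q).const_mul (T p r)
  have hr : HasDerivAt (fun t => ((E t ⊗ₖ E t) * T) p q) ((L * T) p q) 0 := by
    simp only [mul_apply]
    exact HasDerivAt.fun_sum fun r _ => (hkron p r).mul_const (T r q)
  refine hl.unique ?_
  simp only [fun t => (hT (E t) (exp_mem_unitaryGroup (skewAdjoint.smul_mem t hH))).eq, hr]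

theorem commute_kronecker_of_forall_unitary {T : Matrix (n × n) (n × n) ℂ}
    (hT : ∀ V ∈ unitaryGroup n ℂ, Commute T (V ⊗ₖ V)) (M : Matrix n n ℂ) :
    Commute T (M ⊗ₖ (1 : Matrix n n ℂ) + (1 : Matrix n n ℂ) ⊗ₖ M) := by
  have hsa (H : selfAdjoint (Matrix n n ℂ)) :
      Commute T ((H : Matrix n n ℂ) ⊗ₖ (1 : Matrix n n ℂ) +
        (1 : Matrix n n ℂ) ⊗ₖ (H : Matrix n n ℂ)) := by
    have h := commute_kronecker_of_mem_skewAdjoint hT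
      (H.prop.smul_mem_skewAdjoint Complex.conj_I)
    rw [smul_kronecker, kronecker_smul, ← smul_add] at h
    simpa [smul_smul] using h.smul_right (-Complex.I)
  have h := (hsa (realPart M)).add_right ((hsa (imaginaryPart M)).smul_right Complex.I)
  rwa [smul_add, add_add_add_comm, ← smul_kronecker, ← kronecker_smul, ← add_kronecker,
    ← kronecker_add, realPart_add_I_smul_imaginaryPart] at h

theorem card_mul_add_swap_of_forall_unitary {T : Matrix (n × n) (n × n) ℂ}
    (hT : ∀ V ∈ unitaryGroup n ℂ, Commute T (V ⊗ₖ V)) (i k a l : n) :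
    Fintype.card n * T (i, k) (a, l) + T (i, k) (l, a) =
      (1 : Matrix n n ℂ) i a * ∑ j, T (j, k) (j, l) +
        (1 : Matrix n n ℂ) k a * ∑ j, T (i, j) (j, l) := by
  have h (b : n) := congrFun₂ (commute_kronecker_of_forall_unitary hT (single a b 1)).eq
    (i, k) (b, l)
  have hs := Finset.sum_congr rfl fun b (_ : b ∈ Finset.univ) => h b
  simp only [mul_apply, Matrix.add_apply, kroneckerMap_apply, Fintype.sum_prod_type, single_apply,
    mul_add, add_mul, Finset.sum_add_distrib] at hs
  simpa [one_apply, ite_and, Finset.mul_sum, eq_comm (a := i), eq_comm (a := k)] using hs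

theorem trace_conj_unitary (A : Matrix n n ℂ) (U : unitaryGroup n ℂ) :
    ((U : Matrix n n ℂ) * A * (U : Matrix n n ℂ)ᴴ).trace = A.trace := by
  rw [trace_mul_cycle, show (U : Matrix n n ℂ)ᴴ * U = 1 from mem_unitaryGroup_iff'.mp U.2, one_mul]

theorem conj_unitary_mul (A C : Matrix n n ℂ) (U : unitaryGroup n ℂ) :
    ((U : Matrix n n ℂ) * A * (U : Matrix n n ℂ)ᴴ) * (U * C * (U : Matrix n n ℂ)ᴴ) =
      U * (A * C) * (U : Matrix n n ℂ)ᴴ := by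
  have h : (U : Matrix n n ℂ)ᴴ * U = 1 := mem_unitaryGroup_iff'.mp U.2
  calc _ = (U : Matrix n n ℂ) * A * ((U : Matrix n n ℂ)ᴴ * U) * C * (U : Matrix n n ℂ)ᴴ := by
        simp only [mul_assoc]
    _ = _ := by rw [h]; simp only [mul_assoc, one_mul]

end Algebra

section Moments

variable {n : Type*} [Fintype n] [DecidableEq n]
  [MeasurableSpace (unitaryGroup n ℂ)]

/-- The entrywise integral of `U M U†`. -/
noncomputable def firstMoment (μ : Measure (unitaryGroup n ℂ)) (M : Matrix n n ℂ) :
    Matrix n n ℂ :=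
  of fun i j => ∫ U : unitaryGroup n ℂ, ((U : Matrix n n ℂ) * M * (U : Matrix n n ℂ)ᴴ) i j ∂μ

/-- The entrywise integral of `U A U† ⊗ U C U†`. -/
noncomputable def secondMoment (μ : Measure (unitaryGroup n ℂ)) (A C : Matrix n n ℂ) :
    Matrix (n × n) (n × n) ℂ :=
  of fun p q => ∫ U : unitaryGroup n ℂ, (((U : Matrix n n ℂ) * A * (U : Matrix n n ℂ)ᴴ) ⊗ₖ
    ((U : Matrix n n ℂ) * C * (U : Matrix n n ℂ)ᴴ)) p q ∂μ

theorem secondMoment_one_left (μ : Measure (unitaryGroup n ℂ)) (C : Matrix n n ℂ)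
    (i k a l : n) :
    secondMoment μ 1 C (i, k) (a, l) = (1 : Matrix n n ℂ) i a * firstMoment μ C k l := by
  simp only [secondMoment, firstMoment, of_apply, kroneckerMap_apply, ← integral_const_mul]
  refine integral_congr_ae (.of_forall fun U => ?_)
  simp only [mul_one]
  rw [show (U : Matrix n n ℂ) * (U : Matrix n n ℂ)ᴴ = 1 from mem_unitaryGroup_iff.mp U.2]

theorem integrable_of_continuous [BorelSpace (unitaryGroup n ℂ)] (μ : Measure (unitaryGroup n ℂ))
    [IsFiniteMeasure μ] {f : unitaryGroup n ℂ → ℂ} (hf : Continuous f) : Integrable f μ :=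
  hf.integrable_of_hasCompactSupport (HasCompactSupport.of_compactSpace f)

variable [BorelSpace (unitaryGroup n ℂ)] (μ : Measure (unitaryGroup n ℂ))
  [IsProbabilityMeasure μ] (A C : Matrix n n ℂ)

theorem sum_secondMoment_left (k l : n) :
    ∑ j, secondMoment μ A C (j, k) (j, l) = A.trace * firstMoment μ C k l := by
  simp only [secondMoment, firstMoment, of_apply, kroneckerMap_apply]
  rw [← integral_finsetSum _ fun j _ => integrable_of_continuous μ (by fun_prop),
    ← integral_const_mul]
  refine integral_congr_ae (.of_forall fun U => ?_)
  simp only [← Finset.sum_mul]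
  rw [← trace_conj_unitary A U]
  rfl

theorem sum_secondMoment_middle (i l : n) :
    ∑ j, secondMoment μ A C (i, j) (j, l) = firstMoment μ (A * C) i l := by
  simp only [secondMoment, firstMoment, of_apply, kroneckerMap_apply]
  rw [← integral_finsetSum _ fun j _ => integrable_of_continuous μ (by fun_prop)]
  refine integral_congr_ae (.of_forall fun U => ?_)
  simp only [← conj_unitary_mul A C U]
  rw [mul_apply]

theorem trace_firstMoment : (firstMoment μ C).trace = C.trace := by
  simp only [trace, diag_apply, firstMoment, of_apply]
  rw [← integral_finsetSum _ fun j _ => integrable_of_continuous μ (by fun_prop)]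
  have h (U : unitaryGroup n ℂ) := trace_conj_unitary C U
  simp only [trace, diag_apply] at h
  simp [h]

theorem integral_trace_conj_mul (B D : Matrix n n ℂ) :
    ∫ U : unitaryGroup n ℂ, ((U : Matrix n n ℂ) * A * (U : Matrix n n ℂ)ᴴ * B *
        (U : Matrix n n ℂ) * C * (U : Matrix n n ℂ)ᴴ * D).trace ∂μ =
      ∑ i, ∑ j, ∑ k, ∑ l, secondMoment μ A C (i, k) (j, l) * (B j k * D l i) := by
  have h (U : unitaryGroup n ℂ) : ((U : Matrix n n ℂ) * A * (U : Matrix n n ℂ)ᴴ * B *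
        (U : Matrix n n ℂ) * C * (U : Matrix n n ℂ)ᴴ * D).trace =
      ∑ i, ∑ j, ∑ k, ∑ l, (((U : Matrix n n ℂ) * A * (U : Matrix n n ℂ)ᴴ) ⊗ₖ
        ((U : Matrix n n ℂ) * C * (U : Matrix n n ℂ)ᴴ)) (i, k) (j, l) * (B j k * D l i) := by
    set X := (U : Matrix n n ℂ) * A * (U : Matrix n n ℂ)ᴴ with hX
    set Y := (U : Matrix n n ℂ) * C * (U : Matrix n n ℂ)ᴴ with hY
    rw [show X * B * U * C * (U : Matrix n n ℂ)ᴴ * D = X * (B * (Y * D)) by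
      simp only [hY, mul_assoc]]
    simp only [trace, diag_apply, mul_apply (M := X), mul_apply (M := B), mul_apply (M := Y),
      Finset.mul_sum, kroneckerMap_apply]
    refine Finset.sum_congr rfl fun i _ => Finset.sum_congr rfl fun j _ =>
      Finset.sum_congr rfl fun k _ => Finset.sum_congr rfl fun l _ => by ring
  simp only [h, kroneckerMap_apply]
  rw [integral_finsetSum _ fun _ _ => integrable_of_continuous μ (by fun_prop)]
  refine Finset.sum_congr rfl fun i _ => ?_
  rw [integral_finsetSum _ fun _ _ => integrable_of_continuous μ (by fun_prop)]
  refine Finset.sum_congr rfl fun j _ => ?_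
  rw [integral_finsetSum _ fun _ _ => integrable_of_continuous μ (by fun_prop)]
  refine Finset.sum_congr rfl fun k _ => ?_
  rw [integral_finsetSum _ fun _ _ => integrable_of_continuous μ (by fun_prop)]
  refine Finset.sum_congr rfl fun l _ => ?_
  rw [integral_mul_const]
  rfl

variable [μ.IsHaarMeasure]

theorem commute_secondMoment (V : Matrix n n ℂ) (hV : V ∈ unitaryGroup n ℂ) :
    Commute (secondMoment μ A C) (V ⊗ₖ V) := by
  set K : unitaryGroup n ℂ → Matrix (n × n) (n × n) ℂ := fun U =>
    ((U : Matrix n n ℂ) * A * (U : Matrix n n ℂ)ᴴ) ⊗ₖ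
      ((U : Matrix n n ℂ) * C * (U : Matrix n n ℂ)ᴴ) with hK
  have hcont (p q : n × n) : Continuous fun U => K U p q := by
    simp only [hK, kroneckerMap_apply]
    fun_prop
  have hstar : Vᴴ * V = 1 := mem_unitaryGroup_iff'.mp hV
  have hinv (U : unitaryGroup n ℂ) : K (⟨V, hV⟩ * U) * (V ⊗ₖ V) = (V ⊗ₖ V) * K U := by
    simp only [hK, UnitaryGroup.mul_val, conjTranspose_mul, ← mul_kronecker_mul, mul_assoc, hstar,
      mul_one]
  ext p q
  have hl : (secondMoment μ A C * (V ⊗ₖ V)) p q =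
      ∫ U, (K (⟨V, hV⟩ * U) * (V ⊗ₖ V)) p q ∂μ := by
    rw [integral_mul_left_eq_self (fun U => (K U * (V ⊗ₖ V)) p q) ⟨V, hV⟩]
    simp only [mul_apply (N := V ⊗ₖ V)]
    rw [integral_finsetSum _ fun r _ => (integrable_of_continuous μ (hcont p r)).mul_const _]
    simp only [integral_mul_const]
    rfl
  rw [hl]
  simp only [hinv, mul_apply (M := V ⊗ₖ V)]
  rw [integral_finsetSum _ fun r _ => (integrable_of_continuous μ (hcont r q)).const_mul _]
  simp only [integral_const_mul]
  rfl

theorem secondMoment_add_swap (i k a l : n) :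
    Fintype.card n * secondMoment μ A C (i, k) (a, l) + secondMoment μ A C (i, k) (l, a) =
      (1 : Matrix n n ℂ) i a * (A.trace * firstMoment μ C k l) +
        (1 : Matrix n n ℂ) k a * firstMoment μ (A * C) i l := by
  rw [card_mul_add_swap_of_forall_unitary (commute_secondMoment μ A C), sum_secondMoment_left,
    sum_secondMoment_middle]

theorem card_mul_firstMoment (k a : n) :
    Fintype.card n * firstMoment μ C k a = (1 : Matrix n n ℂ) k a * C.trace := by
  have h (i : n) : firstMoment μ C k a = (1 : Matrix n n ℂ) k a * firstMoment μ C i i := by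
    have := secondMoment_add_swap μ 1 C i k a i
    simp only [secondMoment_one_left, trace_one, one_mul, one_apply_eq] at this
    linear_combination this
  have hs := Finset.sum_congr rfl fun i (_ : i ∈ Finset.univ) => h i
  rw [← Finset.mul_sum] at hs
  rw [← trace_firstMoment μ C, trace]
  simpa using hs

theorem secondMoment_eq (hn : 2 ≤ Fintype.card n) (i k j l : n) :
    secondMoment μ A C (i, k) (j, l) =
      (A.trace * C.trace - (A * C).trace / Fintype.card n) / ((Fintype.card n : ℂ) ^ 2 - 1) *
          ((1 : Matrix n n ℂ) i j * (1 : Matrix n n ℂ) k l) +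
        ((A * C).trace - A.trace * C.trace / Fintype.card n) / ((Fintype.card n : ℂ) ^ 2 - 1) *
          ((1 : Matrix n n ℂ) i l * (1 : Matrix n n ℂ) k j) := by
  have h0 : (Fintype.card n : ℂ) ≠ 0 := by
    norm_cast; omega
  have h1 : (Fintype.card n : ℂ) ^ 2 - 1 ≠ 0 := by
    rw [sub_ne_zero]
    norm_cast
    nlinarith
  have hf (M : Matrix n n ℂ) (k a : n) :
      firstMoment μ M k a = (1 : Matrix n n ℂ) k a * M.trace / Fintype.card n := by
    rw [eq_div_iff h0, ← card_mul_firstMoment μ M, mul_comm]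
  have e1 := secondMoment_add_swap μ A C i k j l
  have e2 := secondMoment_add_swap μ A C i k l j
  rw [hf, hf] at e1 e2
  field_simp at e1 e2 ⊢
  linear_combination (Fintype.card n : ℂ) * e1 - e2

end Moments

theorem stmt_5 (d : ℕ) (hd : 2 ≤ d)
    [MeasurableSpace (Matrix.unitaryGroup (Fin d) ℂ)]
    [BorelSpace (Matrix.unitaryGroup (Fin d) ℂ)]
    (μ : Measure (Matrix.unitaryGroup (Fin d) ℂ))
    [μ.IsHaarMeasure] [IsProbabilityMeasure μ]
    (A B C D : Matrix (Fin d) (Fin d) ℂ) :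
    ∫ U : Matrix.unitaryGroup (Fin d) ℂ,
        ((U : Matrix (Fin d) (Fin d) ℂ) * A * (U : Matrix (Fin d) (Fin d) ℂ)ᴴ * B *
          (U : Matrix (Fin d) (Fin d) ℂ) * C * (U : Matrix (Fin d) (Fin d) ℂ)ᴴ * D).trace ∂μ
      = (A.trace * C.trace * (B * D).trace + (A * C).trace * B.trace * D.trace) /
            ((d : ℂ) ^ 2 - 1)
        - ((A * C).trace * (B * D).trace + A.trace * B.trace * C.trace * D.trace) /
            ((d : ℂ) * ((d : ℂ) ^ 2 - 1)) := by
  have h0 : (d : ℂ) ≠ 0 := by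
    norm_cast; omega
  have h1 : (d : ℂ) ^ 2 - 1 ≠ 0 := by
    rw [sub_ne_zero]
    norm_cast
    nlinarith
  rw [integral_trace_conj_mul]
  simp only [secondMoment_eq μ A C (by simpa using hd), Fintype.card_fin]
  generalize hα : (A.trace * C.trace - (A * C).trace / d) / ((d : ℂ) ^ 2 - 1) = α
  generalize hβ : ((A * C).trace - A.trace * C.trace / d) / ((d : ℂ) ^ 2 - 1) = β
  have hsum : ∑ i, ∑ j, ∑ k, ∑ l, (α * ((1 : Matrix (Fin d) (Fin d) ℂ) i j *
        (1 : Matrix (Fin d) (Fin d) ℂ) k l) + β * ((1 : Matrix (Fin d) (Fin d) ℂ) i l *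
        (1 : Matrix (Fin d) (Fin d) ℂ) k j)) * (B j k * D l i) =
      α * (B * D).trace + β * (B.trace * D.trace) := by
    simp only [add_mul, Finset.sum_add_distrib]
    congr 1
    · simp [one_apply, trace, mul_apply, Finset.mul_sum]
    · simp [one_apply, trace, Finset.mul_sum, Finset.sum_mul]
  rw [hsum, ← hα, ← hβ]
  field_simp
  ring
end

section
/- Let d ≥ 2 and let μ be the normalized Haar probability measure on the unitary group U(d) of d × d complex unitary matrices. Then for all complex d × d matrices A, B, C, D, ∫_{U(d)} Tr(U A U† B)·Tr(U C U† D) dμ(U) = [Tr(AC)Tr(BD) + Tr(A)Tr(B)Tr(C)Tr(D)]/(d² − 1) − [Tr(A)Tr(C)Tr(BD) + Tr(AC)Tr(B)Tr(D)]/(d(d² − 1)). -/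
open Matrix MeasureTheory

theorem conj_apply_mul_conj_apply {n : Type*} [Fintype n] (V X Y : Matrix n n ℂ) (i j k l : n) :
    (V * X * Vᴴ) i j * (V * Y * Vᴴ) k l =
      ∑ a, ∑ b, ∑ c, ∑ e,
        V i a * star (V j b) * V k c * star (V l e) * (X a b * Y c e) := by
  have hconj (M : Matrix n n ℂ) (i j : n) :
      (V * M * Vᴴ) i j = ∑ a, ∑ b, V i a * star (V j b) * M a b := by
    rw [mul_apply, Finset.sum_comm]
    refine Finset.sum_congr rfl fun b _ => ?_
    rw [mul_apply, Finset.sum_mul]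
    refine Finset.sum_congr rfl fun a _ => ?_
    rw [conjTranspose_apply]
    ring
  simp only [hconj, Finset.sum_mul]
  simp only [Finset.mul_sum]
  refine Finset.sum_congr rfl fun a _ => Finset.sum_congr rfl fun b _ =>
    Finset.sum_congr rfl fun c _ => Finset.sum_congr rfl fun e _ => ?_
  ring

section Commutant

variable {n : Type*} [Fintype n] [DecidableEq n]

/-- A four-index tensor invariant under conjugation by `V ⊗ V` for all unitary `V`. -/
def IsUnitaryInvariant (F : n → n → n → n → ℂ) : Prop :=
  ∀ V ∈ unitaryGroup n ℂ, ∀ i j k l,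
    ∑ a, ∑ b, ∑ c, ∑ e, V i a * star (V j b) * V k c * star (V l e) * F a b c e = F i j k l

namespace IsUnitaryInvariant

variable {F : n → n → n → n → ℂ}

theorem diagonal_phase (hF : IsUnitaryInvariant F) (v : n → ℂ) (hv : ∀ i, v i * star (v i) = 1)
    (i j k l : n) : v i * star (v j) * v k * star (v l) * F i j k l = F i j k l := by
  have hV : diagonal v ∈ unitaryGroup n ℂ := by
    rw [mem_unitaryGroup_iff, star_eq_conjTranspose, diagonal_conjTranspose, diagonal_mul_diagonal,
      ← diagonal_one]
    congr 1
    ext i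
    exact hv i
  have h := hF _ hV i j k l
  simpa [diagonal_apply, apply_ite, ite_mul] using h

theorem perm (hF : IsUnitaryInvariant F) (σ : Equiv.Perm n) (i j k l : n) :
    F (σ i) (σ j) (σ k) (σ l) = F i j k l := by
  have hV : (of fun i j => if σ i = j then (1 : ℂ) else 0) ∈ unitaryGroup n ℂ := by
    rw [mem_unitaryGroup_iff]
    ext i j
    simp [mul_apply, one_apply, star_apply, apply_ite, eq_comm]
  have h := hF _ hV i j k l
  simpa [apply_ite, ite_mul] using h

theorem eq_zero (hF : IsUnitaryInvariant F) {i j k l : n}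
    (h : ¬(i = j ∧ k = l) ∧ ¬(i = l ∧ k = j)) : F i j k l = 0 := by
  have key (p : n) := hF.diagonal_phase (fun x => if x = p then Complex.I else 1)
    (fun x => by split_ifs <;> simp) i j k l
  have hI : Complex.I ≠ 1 := by simp [Complex.ext_iff]
  obtain ⟨h₁, h₂⟩ := h
  by_cases hij : i = j
  · subst hij
    have hkl : l ≠ k := fun h => h₁ ⟨rfl, h.symm⟩
    have := key k
    exact eq_zero_of_mul_eq_self_left hI (by by_cases hik : i = k <;> simpa [hkl, hik] using this)
  · by_cases hil : i = l
    · subst hil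
      have hkj : j ≠ k := fun h => h₂ ⟨rfl, h.symm⟩
      have := key k
      exact eq_zero_of_mul_eq_self_left hI (by by_cases hik : i = k <;> simpa [hkj, hik] using this)
    · have := key i
      by_cases hik : k = i
      · simp [Ne.symm hij, Ne.symm hil, hik] at this
        rw [hik]
        linear_combination (-1 / 2 : ℂ) * this
      · simp [Ne.symm hij, Ne.symm hil, hik] at this
        exact eq_zero_of_mul_eq_self_left hI this

theorem apply_diag (hF : IsUnitaryInvariant F) {p q : n} (hpq : p ≠ q) :
    F p p p p = F p p q q + F p q q p := by
  let y : n → ℂ := Pi.single p 1 - (2 : ℂ) • Pi.single q 1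
  have hy : y ⬝ᵥ y = 5 := by
    simp [y, hpq, hpq.symm]
    norm_num
  have hsy : star y = y := by
    ext i
    by_cases hp : i = p <;> by_cases hq : i = q <;> simp_all [y]
  have hV : 1 - (2 / 5 : ℂ) • vecMulVec y y ∈ unitaryGroup n ℂ := by
    have hs : star (1 - (2 / 5 : ℂ) • vecMulVec y y) = 1 - (2 / 5 : ℂ) • vecMulVec y y := by
      simp [star_eq_conjTranspose, conjTranspose_vecMulVec, hsy]
    rw [mem_unitaryGroup_iff, hs]
    simp only [mul_sub, sub_mul, one_mul, mul_one, smul_mul_smul_comm, vecMulVec_mul_vecMulVec, hy]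
    ext i j
    simp [vecMulVec_apply]
    ring
  have hrow (f : n → ℂ) :
      ∑ a, (1 - (2 / 5 : ℂ) • vecMulVec y y) p a * f a = 3 / 5 * f p + 4 / 5 * f q := by
    simp [y, vecMulVec_apply, one_apply, sub_mul, mul_sub, Finset.sum_sub_distrib,
      Pi.single_apply, hpq]
    ring
  have hrow_star (f : n → ℂ) :
      ∑ a, star ((1 - (2 / 5 : ℂ) • vecMulVec y y) p a) * f a = 3 / 5 * f p + 4 / 5 * f q := by
    rw [← hrow]
    refine Finset.sum_congr rfl fun a _ => ?_
    have hya : star (y a) = y a := congr_fun hsy a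
    have hyp : star (y p) = y p := congr_fun hsy p
    by_cases hpa : p = a <;> simp_all [vecMulVec_apply, one_apply]
  have h := hF _ hV p p p p
  simp only [mul_assoc, ← Finset.mul_sum, hrow, hrow_star] at h
  have hqp := hpq.symm
  have e1 : F q q q q = F p p p p := by simpa using hF.perm (Equiv.swap p q) p p p p
  have e2 : F q q p p = F p p q q := by simpa using hF.perm (Equiv.swap p q) p p q q
  have e3 : F q p p q = F p q q p := by simpa using hF.perm (Equiv.swap p q) p q q p
  rw [e1, e2, e3, hF.eq_zero (i := p) (j := p) (k := p) (l := q) (by tauto),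
    hF.eq_zero (i := p) (j := p) (k := q) (l := p) (by tauto),
    hF.eq_zero (i := p) (j := q) (k := p) (l := p) (by tauto),
    hF.eq_zero (i := q) (j := p) (k := p) (l := p) (by tauto),
    hF.eq_zero (i := p) (j := q) (k := p) (l := q) (by tauto),
    hF.eq_zero (i := q) (j := p) (k := q) (l := p) (by tauto),
    hF.eq_zero (i := p) (j := q) (k := q) (l := q) (by tauto),
    hF.eq_zero (i := q) (j := p) (k := q) (l := q) (by tauto),
    hF.eq_zero (i := q) (j := q) (k := p) (l := q) (by tauto),
    hF.eq_zero (i := q) (j := q) (k := q) (l := p) (by tauto)] at h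
  linear_combination (-625 / 288 : ℂ) * h

theorem exists_eq [Nontrivial n] (hF : IsUnitaryInvariant F) :
    ∃ a b : ℂ, ∀ i j k l, F i j k l =
      (if i = j then 1 else 0) * (if k = l then 1 else 0) * a +
        (if i = l then 1 else 0) * (if k = j then 1 else 0) * b := by
  obtain ⟨p, q, hpq⟩ := exists_pair_ne n
  have htrans {i k : n} (hik : i ≠ k) : ∃ σ : Equiv.Perm n, σ p = i ∧ σ q = k := by
    refine ⟨Equiv.swap (Equiv.swap p i q) k * Equiv.swap p i, ?_, by simp⟩
    have : i ≠ Equiv.swap p i q := fun h => hpq ((Equiv.swap p i).injective (by simpa using h))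
    simp [Equiv.swap_apply_of_ne_of_ne this hik]
  have ha {i k : n} (hik : i ≠ k) : F i i k k = F p p q q := by
    obtain ⟨σ, rfl, rfl⟩ := htrans hik
    exact hF.perm σ p p q q
  have hb {i k : n} (hik : i ≠ k) : F i k k i = F p q q p := by
    obtain ⟨σ, rfl, rfl⟩ := htrans hik
    exact hF.perm σ p q q p
  refine ⟨F p p q q, F p q q p, fun i j k l => ?_⟩
  by_cases h₁ : i = j ∧ k = l
  · obtain ⟨rfl, rfl⟩ := h₁
    by_cases hik : i = k
    · subst hik
      obtain ⟨m, hm⟩ := exists_ne i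
      simp [hF.apply_diag hm.symm, ha hm.symm, hb hm.symm]
    · simp [hik, ha hik]
  · by_cases h₂ : i = l ∧ k = j
    · obtain ⟨rfl, rfl⟩ := h₂
      have hik : i ≠ k := fun h => h₁ ⟨h, h.symm⟩
      simp [hik, hb hik]
    · rw [hF.eq_zero ⟨h₁, h₂⟩]
      rw [not_and_or] at h₁ h₂
      rcases h₁ with h₁ | h₁ <;> rcases h₂ with h₂ | h₂ <;> simp [h₁, h₂]

/-- Pairing an invariant tensor with `B` and `D`, in terms of its two partial traces `s` and `t`. -/
theorem sum_mul_eq (hF : IsUnitaryInvariant F) (hn : 2 ≤ Fintype.card n) {s t : ℂ}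
    (hs : ∑ i, ∑ k, F i i k k = s) (ht : ∑ i, ∑ k, F i k k i = t) (B D : Matrix n n ℂ) :
    ∑ i, ∑ j, ∑ k, ∑ l, F i j k l * (B j i * D l k) =
      (t * (B * D).trace + s * B.trace * D.trace) / ((Fintype.card n : ℂ) ^ 2 - 1) -
        (s * (B * D).trace + t * B.trace * D.trace) /
          (Fintype.card n * ((Fintype.card n : ℂ) ^ 2 - 1)) := by
  have : Nontrivial n := Fintype.one_lt_card_iff_nontrivial.mp hn
  obtain ⟨a, b, hab⟩ := hF.exists_eq
  have hd : (Fintype.card n : ℂ) ≠ 0 := by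
    norm_cast
    omega
  have hd' : (Fintype.card n : ℂ) ^ 2 - 1 ≠ 0 := by
    rw [sub_ne_zero]
    norm_cast
    nlinarith
  have hs' : (Fintype.card n : ℂ) ^ 2 * a + Fintype.card n * b = s := by
    rw [← hs]
    simp [hab, Finset.sum_add_distrib]
    ring
  have ht' : Fintype.card n * a + (Fintype.card n : ℂ) ^ 2 * b = t := by
    rw [← ht]
    simp [hab, Finset.sum_add_distrib]
    ring
  have hsum : ∑ i, ∑ j, ∑ k, ∑ l, F i j k l * (B j i * D l k) =
      a * (B.trace * D.trace) + b * (B * D).trace := by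
    simp only [hab, add_mul, Finset.sum_add_distrib]
    congr 1
    · rw [trace, trace, Finset.sum_mul_sum, Finset.mul_sum]
      simp [Finset.mul_sum, mul_comm]
    · rw [trace_mul_comm]
      simp [trace, mul_apply, Finset.mul_sum, mul_comm]
  rw [hsum, ← hs', ← ht']
  field_simp
  ring

end IsUnitaryInvariant

end Commutant

section Haar

variable {n : Type*} [Fintype n] [DecidableEq n]

theorem continuous_conj_apply (A : Matrix n n ℂ) (i j : n) :
    Continuous fun U : unitaryGroup n ℂ => (U.1 * A * U.1ᴴ) i j := by
  have h : Continuous fun U : unitaryGroup n ℂ => U.1 * A * U.1ᴴ := by fun_prop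
  exact h.matrix_elem i j

theorem norm_conj_apply_le (A : Matrix n n ℂ) (U : unitaryGroup n ℂ) (i j : n) :
    ‖(U.1 * A * U.1ᴴ) i j‖ ≤ ∑ b, ∑ a, ‖A a b‖ := by
  simp only [mul_apply, Finset.sum_mul]
  refine (norm_sum_le _ _).trans (Finset.sum_le_sum fun b _ => (norm_sum_le _ _).trans
    (Finset.sum_le_sum fun a _ => ?_))
  rw [norm_mul, norm_mul, conjTranspose_apply, norm_star]
  have h₁ := entry_norm_bound_of_unitary U.2 i a
  have h₂ := entry_norm_bound_of_unitary U.2 j b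
  calc ‖U.1 i a‖ * ‖A a b‖ * ‖U.1 j b‖ ≤ 1 * ‖A a b‖ * 1 := by gcongr
    _ = ‖A a b‖ := by ring

variable [MeasurableSpace (unitaryGroup n ℂ)] [BorelSpace (unitaryGroup n ℂ)]
  {μ : Measure (unitaryGroup n ℂ)}

theorem integrable_conj_mul_conj [IsFiniteMeasure μ] (A C : Matrix n n ℂ) (i j k l : n) :
    Integrable (fun U : unitaryGroup n ℂ => (U.1 * A * U.1ᴴ) i j * (U.1 * C * U.1ᴴ) k l) μ := by
  refine Integrable.of_bound
    ((continuous_conj_apply A i j).mul (continuous_conj_apply C k l)).aestronglyMeasurable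
    ((∑ b, ∑ a, ‖A a b‖) * ∑ b, ∑ a, ‖C a b‖) (.of_forall fun U => ?_)
  rw [norm_mul]
  exact mul_le_mul (norm_conj_apply_le A U i j) (norm_conj_apply_le C U k l) (norm_nonneg _)
    (by positivity)

theorem integral_sum_mul_conj_mul_conj [IsFiniteMeasure μ] (A C : Matrix n n ℂ)
    (w : n → n → n → n → ℂ) :
    ∫ U : unitaryGroup n ℂ, ∑ i, ∑ j, ∑ k, ∑ l,
        w i j k l * ((U.1 * A * U.1ᴴ) i j * (U.1 * C * U.1ᴴ) k l) ∂μ =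
      ∑ i, ∑ j, ∑ k, ∑ l,
        w i j k l * ∫ U : unitaryGroup n ℂ, (U.1 * A * U.1ᴴ) i j * (U.1 * C * U.1ᴴ) k l ∂μ := by
  have h (i j k l : n) := (integrable_conj_mul_conj (μ := μ) A C i j k l).const_mul (w i j k l)
  have h₁ (i j k : n) := integrable_finsetSum Finset.univ fun l _ => h i j k l
  have h₂ (i j : n) := integrable_finsetSum Finset.univ fun k _ => h₁ i j k
  have h₃ (i : n) := integrable_finsetSum Finset.univ fun j _ => h₂ i j
  rw [integral_finsetSum _ fun i _ => h₃ i]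
  refine Finset.sum_congr rfl fun i _ => ?_
  rw [integral_finsetSum _ fun j _ => h₂ i j]
  refine Finset.sum_congr rfl fun j _ => ?_
  rw [integral_finsetSum _ fun k _ => h₁ i j k]
  refine Finset.sum_congr rfl fun k _ => ?_
  rw [integral_finsetSum _ fun l _ => h i j k l]
  exact Finset.sum_congr rfl fun l _ => integral_const_mul _ _

theorem isUnitaryInvariant_integral [IsFiniteMeasure μ] [μ.IsMulLeftInvariant]
    (A C : Matrix n n ℂ) :
    IsUnitaryInvariant fun i j k l =>
      ∫ U : unitaryGroup n ℂ, (U.1 * A * U.1ᴴ) i j * (U.1 * C * U.1ᴴ) k l ∂μ := by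
  intro V hV i j k l
  rw [← integral_sum_mul_conj_mul_conj]
  beta_reduce
  rw [← integral_mul_left_eq_self (μ := μ) (fun U : unitaryGroup n ℂ =>
    (U.1 * A * U.1ᴴ) i j * (U.1 * C * U.1ᴴ) k l) ⟨V, hV⟩]
  refine integral_congr_ae (.of_forall fun U => ?_)
  have hassoc (M : Matrix n n ℂ) : V * U.1 * M * (V * U.1)ᴴ = V * (U.1 * M * U.1ᴴ) * Vᴴ := by
    simp only [conjTranspose_mul, Matrix.mul_assoc]
  simp only [UnitaryGroup.mul_val, hassoc, conj_apply_mul_conj_apply]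

end Haar

theorem stmt_6 (d : ℕ) (hd : 2 ≤ d)
    [MeasurableSpace (Matrix.unitaryGroup (Fin d) ℂ)]
    [BorelSpace (Matrix.unitaryGroup (Fin d) ℂ)]
    (μ : Measure (Matrix.unitaryGroup (Fin d) ℂ))
    [μ.IsHaarMeasure] [IsProbabilityMeasure μ]
    (A B C D : Matrix (Fin d) (Fin d) ℂ) :
    ∫ U : Matrix.unitaryGroup (Fin d) ℂ,
        ((U : Matrix (Fin d) (Fin d) ℂ) * A * (U : Matrix (Fin d) (Fin d) ℂ)ᴴ * B).trace *
        ((U : Matrix (Fin d) (Fin d) ℂ) * C * (U : Matrix (Fin d) (Fin d) ℂ)ᴴ * D).trace ∂μ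
      = ((A * C).trace * (B * D).trace + A.trace * B.trace * C.trace * D.trace) /
            ((d : ℂ) ^ 2 - 1)
        - (A.trace * C.trace * (B * D).trace + (A * C).trace * B.trace * D.trace) /
            ((d : ℂ) * ((d : ℂ) ^ 2 - 1)) := by
  have hU (U : unitaryGroup (Fin d) ℂ) : U.1ᴴ * U.1 = 1 := UnitaryGroup.star_mul_self U
  have htr (U : unitaryGroup (Fin d) ℂ) (M : Matrix (Fin d) (Fin d) ℂ) :
      (U.1 * M * U.1ᴴ).trace = M.trace := by
    rw [trace_mul_comm, ← Matrix.mul_assoc, hU, Matrix.one_mul]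
  have hint := integrable_conj_mul_conj (μ := μ) A C
  have hs : ∑ i, ∑ k, ∫ U : unitaryGroup (Fin d) ℂ,
      (U.1 * A * U.1ᴴ) i i * (U.1 * C * U.1ᴴ) k k ∂μ = A.trace * C.trace := by
    simp_rw [← integral_finsetSum _ fun k _ => hint _ _ k k]
    rw [← integral_finsetSum _ fun i _ => integrable_finsetSum _ fun k _ => hint i i k k]
    have h (U : unitaryGroup (Fin d) ℂ) :
        ∑ i, ∑ k, (U.1 * A * U.1ᴴ) i i * (U.1 * C * U.1ᴴ) k k = A.trace * C.trace := by
      rw [← htr U A, ← htr U C, trace, trace, Finset.sum_mul_sum]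
      rfl
    simp [h]
  have ht : ∑ i, ∑ k, ∫ U : unitaryGroup (Fin d) ℂ,
      (U.1 * A * U.1ᴴ) i k * (U.1 * C * U.1ᴴ) k i ∂μ = (A * C).trace := by
    simp_rw [← integral_finsetSum _ fun k _ => hint _ k k _]
    rw [← integral_finsetSum _ fun i _ => integrable_finsetSum _ fun k _ => hint i k k i]
    have h (U : unitaryGroup (Fin d) ℂ) :
        ∑ i, ∑ k, (U.1 * A * U.1ᴴ) i k * (U.1 * C * U.1ᴴ) k i = (A * C).trace := by
      have hAC : U.1 * A * U.1ᴴ * (U.1 * C * U.1ᴴ) = U.1 * (A * C) * U.1ᴴ := by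
        rw [show U.1 * A * U.1ᴴ * (U.1 * C * U.1ᴴ) = U.1 * A * (U.1ᴴ * U.1) * C * U.1ᴴ by
          simp only [Matrix.mul_assoc], hU, Matrix.mul_one, Matrix.mul_assoc U.1 A C]
      rw [← htr U (A * C), ← hAC]
      rfl
    simp [h]
  have key := (isUnitaryInvariant_integral (μ := μ) A C).sum_mul_eq (by simpa using hd) hs ht B D
  simp only [Fintype.card_fin] at key
  have hexp (U : unitaryGroup (Fin d) ℂ) :
      (U.1 * A * U.1ᴴ * B).trace * (U.1 * C * U.1ᴴ * D).trace =
        ∑ i, ∑ j, ∑ k, ∑ l,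
          B j i * D l k * ((U.1 * A * U.1ᴴ) i j * (U.1 * C * U.1ᴴ) k l) := by
    simp only [trace, diag_apply, mul_apply (N := B), mul_apply (N := D), Finset.sum_mul]
    simp only [Finset.mul_sum]
    refine Finset.sum_congr rfl fun i _ => Finset.sum_congr rfl fun j _ =>
      Finset.sum_congr rfl fun k _ => Finset.sum_congr rfl fun l _ => ?_
    ring
  simp only [hexp]
  rw [integral_sum_mul_conj_mul_conj]
  simp only [mul_comm _ (∫ _, _ ∂μ)]
  rw [key]
  ring
end

section
/- Let d ≥ 1 and let μ be the normalized Haar probability measure on the unitary group U(d) of d × d complex unitary matrices. Then for all complex d × d matrices O, P, σ, ∫_{U(d)} Tr(U† O U · (Pσ − σP)) dμ(U) = 0. (This is the vanishing of the mean of the VSQL gradient ∂o_i/∂θ_l = −(i/2)·Tr(U_{>l}† O U_{>l}·[P_l, U_{≤l} ρ U_{≤l}†]) when U_{>l} is Haar-distributed.) -/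
open Matrix MeasureTheory

theorem isCompact_unitaryGroup (n : Type*) [Fintype n] [DecidableEq n] :
    IsCompact (Matrix.unitaryGroup n ℂ : Set (Matrix n n ℂ)) := by
  have hK : IsCompact (Set.univ.pi fun _ : n => Set.univ.pi fun _ : n =>
      Metric.closedBall (0 : ℂ) 1) :=
    isCompact_univ_pi fun _ => isCompact_univ_pi fun _ => isCompact_closedBall 0 1
  have hc : IsClosed (Matrix.unitaryGroup n ℂ : Set (Matrix n n ℂ)) := isClosed_unitary
  refine hK.of_isClosed_subset hc fun U hU i _ j _ => ?_
  simpa using entry_norm_bound_of_unitary hU i j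

instance compactSpace_unitaryGroup (n : Type*) [Fintype n] [DecidableEq n] :
    CompactSpace (Matrix.unitaryGroup n ℂ) :=
  isCompact_iff_compactSpace.1 (isCompact_unitaryGroup n)

open scoped Matrix.Norms.L2Operator in
theorem span_unitaryGroup (n : Type*) [Fintype n] [DecidableEq n] :
    Submodule.span ℂ (Matrix.unitaryGroup n ℂ : Set (Matrix n n ℂ)) = ⊤ :=
  CStarAlgebra.span_unitary _

/-- A Haar probability measure on a compact group is right invariant. -/
theorem isMulRightInvariant_of_compactSpace {G : Type*} [Group G] [TopologicalSpace G]
    [IsTopologicalGroup G] [CompactSpace G] [MeasurableSpace G] [BorelSpace G]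
    (μ : Measure G) [μ.IsHaarMeasure] [IsProbabilityMeasure μ] : μ.IsMulRightInvariant where
  map_mul_right_eq_self g := by
    have : IsProbabilityMeasure (μ.map (· * g)) :=
      Measure.isProbabilityMeasure_map (measurable_mul_const g).aemeasurable
    exact Measure.isHaarMeasure_eq_of_isProbabilityMeasure _ _

/-- A linear functional on matrices that is invariant under unitary conjugation
vanishes on commutators. -/
theorem map_commutator_eq_zero_of_unitary_invariant {n : Type*} [Fintype n] [DecidableEq n]
    (φ : Matrix n n ℂ →ₗ[ℂ] ℂ)
    (hφ : ∀ V ∈ Matrix.unitaryGroup n ℂ, ∀ A, φ (V * A * Vᴴ) = φ A)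
    (P σ : Matrix n n ℂ) : φ (P * σ - σ * P) = 0 := by
  have hP : P ∈ Submodule.span ℂ (Matrix.unitaryGroup n ℂ : Set (Matrix n n ℂ)) := by
    simp [span_unitaryGroup]
  induction hP using Submodule.span_induction with
  | mem V hV =>
    have h := hφ V hV (σ * V)
    have hV' : V * Vᴴ = 1 := Matrix.mem_unitaryGroup_iff.1 hV
    rw [← mul_assoc, mul_assoc (V * σ), hV', mul_one] at h
    rw [map_sub, h, sub_self]
  | zero => simp
  | add A B _ _ hA hB =>
    rw [add_mul, mul_add, add_sub_add_comm, map_add, hA, hB, add_zero]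
  | smul c A _ hA =>
    rw [smul_mul_assoc, mul_smul_comm, ← smul_sub, map_smul, hA, smul_zero]

theorem stmt_7 (d : ℕ) (hd : 1 ≤ d)
    [MeasurableSpace (Matrix.unitaryGroup (Fin d) ℂ)]
    [BorelSpace (Matrix.unitaryGroup (Fin d) ℂ)]
    (μ : Measure (Matrix.unitaryGroup (Fin d) ℂ))
    [μ.IsHaarMeasure] [IsProbabilityMeasure μ]
    (O P σ : Matrix (Fin d) (Fin d) ℂ) :
    ∫ U : Matrix.unitaryGroup (Fin d) ℂ,
        ((U : Matrix (Fin d) (Fin d) ℂ)ᴴ * O * (U : Matrix (Fin d) (Fin d) ℂ) *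
          (P * σ - σ * P)).trace ∂μ = 0 := by
  have := isMulRightInvariant_of_compactSpace μ
  have hint (A : Matrix (Fin d) (Fin d) ℂ) :
      Integrable (fun U : Matrix.unitaryGroup (Fin d) ℂ =>
        ((U : Matrix (Fin d) (Fin d) ℂ)ᴴ * O * (U : Matrix (Fin d) (Fin d) ℂ) * A).trace) μ := by
    refine Continuous.integrable_of_hasCompactSupport ?_ (HasCompactSupport.of_compactSpace _)
    fun_prop
  let φ : Matrix (Fin d) (Fin d) ℂ →ₗ[ℂ] ℂ :=
    { toFun A := ∫ U : Matrix.unitaryGroup (Fin d) ℂ,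
        ((U : Matrix (Fin d) (Fin d) ℂ)ᴴ * O * (U : Matrix (Fin d) (Fin d) ℂ) * A).trace ∂μ
      map_add' A B := by
        simp only [mul_add, Matrix.trace_add]
        exact integral_add (hint A) (hint B)
      map_smul' c A := by
        simp only [mul_smul_comm, Matrix.trace_smul, RingHom.id_apply]
        exact integral_smul c _ }
  refine map_commutator_eq_zero_of_unitary_invariant φ (fun V hV A => ?_) P σ
  refine Eq.trans ?_ (integral_mul_right_eq_self (μ := μ) _ (⟨V, hV⟩ : unitaryGroup (Fin d) ℂ))
  refine integral_congr_ae (.of_forall fun U => ?_)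
  simp only [Submonoid.coe_mul, conjTranspose_mul, ← mul_assoc]
  rw [Matrix.trace_mul_comm]
  simp only [← mul_assoc]
end

section
/- Let P be a complex Hermitian d × d matrix with P² = I (i.e. a Hermitian involution), and let ρ be a density matrix of size d (complex positive semidefinite with trace 1). Then −4 ≤ Tr((Pρ − ρP)²) ≤ 0, i.e. the trace of the squared commutator [P, ρ]² is a real number lying in the interval [−4, 0]. -/
open Matrix ComplexOrder

/-- The trace of the square of a Hermitian matrix is the sum of its squared eigenvalues. -/
theorem Matrix.IsHermitian.trace_mul_self_eq_sum_sq_eigenvalues {n : Type*} [Fintype n]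
    [DecidableEq n] {A : Matrix n n ℂ} (hA : A.IsHermitian) :
    (A * A).trace = ((∑ i, hA.eigenvalues i ^ 2 : ℝ) : ℂ) := by
  conv_lhs => rw [hA.spectral_theorem, ← map_mul, Unitary.conjStarAlgAut_apply,
    Matrix.trace_mul_cycle, Unitary.coe_star_mul_self, one_mul, diagonal_mul_diagonal,
    trace_diagonal]
  simp [sq]

/-- For a positive semidefinite matrix, the trace of the square is at most the squared trace. -/
theorem Matrix.PosSemidef.trace_mul_self_le_sq_trace {n : Type*} [Fintype n]
    {A : Matrix n n ℂ} (hA : A.PosSemidef) :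
    (A * A).trace ≤ A.trace ^ 2 := by
  classical
  have h_trace : A.trace = ((∑ i, hA.1.eigenvalues i : ℝ) : ℂ) := by
    simpa using hA.1.trace_eq_sum_eigenvalues
  rw [hA.1.trace_mul_self_eq_sum_sq_eigenvalues, h_trace, ← Complex.ofReal_pow]
  have h := Finset.sum_sq_le_sq_sum_of_nonneg (s := Finset.univ)
    (f := hA.1.eigenvalues) fun i _ => hA.eigenvalues_nonneg i
  exact Complex.real_le_real.mpr h

/-- The trace of `(P * A) ^ 2` is nonnegative for `P` Hermitian and `A` positive semidefinite. -/
theorem Matrix.PosSemidef.trace_hermitian_mul_mul_hermitian_mul_nonneg {n : Type*} [Fintype n]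
    {P A : Matrix n n ℂ} (hA : A.PosSemidef) (hP : P.IsHermitian) :
    0 ≤ (P * A * (P * A)).trace := by
  classical
  open scoped MatrixOrder in
  obtain ⟨B, rfl⟩ := CStarAlgebra.nonneg_iff_eq_star_mul_self.mp hA.nonneg
  have h := (posSemidef_conjTranspose_mul_self (B * P * Bᴴ)).trace_nonneg
  have h_eq : (P * (star B * B) * (P * (star B * B))).trace
      = ((B * P * Bᴴ)ᴴ * (B * P * Bᴴ)).trace := by
    simp only [star_eq_conjTranspose, conjTranspose_mul, conjTranspose_conjTranspose, hP.eq]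
    rw [← Matrix.mul_assoc, ← Matrix.mul_assoc, Matrix.trace_mul_comm]
    simp only [Matrix.mul_assoc]
  rwa [h_eq]

theorem stmt_10 (d : ℕ) (P ρ : Matrix (Fin d) (Fin d) ℂ)
    (hP : P.IsHermitian) (hP2 : P * P = 1)
    (hρ : ρ.PosSemidef) (hρt : ρ.trace = 1) :
    ∃ r : ℝ, ((P * ρ - ρ * P) ^ 2).trace = (r : ℂ) ∧ -4 ≤ r ∧ r ≤ 0 := by
  have h_le : ((P * ρ - ρ * P) ^ 2).trace ≤ 0 := by
    have h := (posSemidef_conjTranspose_mul_self (P * ρ - ρ * P)).trace_nonneg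
    have h_skew : (P * ρ - ρ * P)ᴴ = -(P * ρ - ρ * P) := by
      simp [conjTranspose_sub, conjTranspose_mul, hP.eq, hρ.1.eq]
    rw [h_skew, Matrix.neg_mul, trace_neg, ← sq] at h
    exact neg_nonneg.mp h
  have h_eq : ((P * ρ - ρ * P) ^ 2).trace
      = 2 * (P * ρ * (P * ρ)).trace - 2 * (ρ * ρ).trace := by
    have h₁ : (ρ * P * (ρ * P)).trace = (P * ρ * (P * ρ)).trace := by
      rw [Matrix.mul_assoc, Matrix.trace_mul_comm]
      simp only [Matrix.mul_assoc]
    have h₂ : (ρ * P * (P * ρ)).trace = (ρ * ρ).trace := by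
      rw [Matrix.mul_assoc, ← Matrix.mul_assoc P, hP2, Matrix.one_mul]
    have h₃ : (P * ρ * (ρ * P)).trace = (ρ * ρ).trace := by
      rw [Matrix.trace_mul_comm, h₂]
    rw [sq, Matrix.sub_mul, Matrix.mul_sub, Matrix.mul_sub, trace_sub, trace_sub, trace_sub,
      h₁, h₂, h₃]
    ring
  have h_nonneg := hρ.trace_hermitian_mul_mul_hermitian_mul_nonneg hP
  have h_purity := hρ.trace_mul_self_le_sq_trace
  rw [hρt] at h_purity
  rw [Complex.le_def] at h_le h_nonneg h_purity
  refine ⟨((P * ρ - ρ * P) ^ 2).trace.re, Complex.ext rfl (by simpa using h_le.2), ?_,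
    by simpa using h_le.1⟩
  rw [h_eq]
  simp at h_nonneg h_purity ⊢
  linarith [h_nonneg.1, h_purity.1]
end

section
/- Let d ≥ 1, let P be a real d × d doubly stochastic matrix (all entries nonnegative, every row sums to 1, every column sums to 1), and let λ : Fin d → ℝ be a monotonically decreasing vector (λ₁ ≥ λ₂ ≥ ⋯ ≥ λ_d). Then ∑_{i=1}^{d} λ_i·λ_{d−i+1} ≤ λᵀ P λ ≤ ∑_{i=1}^{d} λ_i², where λᵀ P λ = ∑_{i,j} λ_i·P_{ij}·λ_j. -/
/-- The bilinear form of a doubly stochastic matrix is a convex combination of the bilinear forms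
of permutation matrices. -/
theorem exists_weights_sum_mul_of_mem_doublyStochastic {n : Type*} [Fintype n] [DecidableEq n]
    {M : Matrix n n ℝ} (hM : M ∈ doublyStochastic ℝ n) (f g : n → ℝ) :
    ∃ w : Equiv.Perm n → ℝ, (∀ σ, 0 ≤ w σ) ∧ ∑ σ, w σ = 1 ∧
      ∑ i, ∑ j, f i * M i j * g j = ∑ σ, w σ * ∑ i, f i * g (σ i) := by
  obtain ⟨w, hw, hw_sum, rfl⟩ := exists_eq_sum_perm_of_mem_doublyStochastic hM
  refine ⟨w, hw, hw_sum, ?_⟩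
  have row (i : n) : ∑ j, f i * (∑ σ, w σ • σ.permMatrix ℝ : Matrix n n ℝ) i j * g j
      = ∑ σ, w σ * (f i * g (σ i)) := by
    simp only [Matrix.sum_apply, Matrix.smul_apply, smul_eq_mul, Finset.mul_sum, Finset.sum_mul]
    rw [Finset.sum_comm]
    refine Finset.sum_congr rfl fun σ _ => ?_
    simp [Equiv.Perm.permMatrix, Equiv.toPEquiv_apply, PEquiv.toMatrix_apply]
    ring
  simp only [row, Finset.mul_sum]
  exact Finset.sum_comm

theorem stmt_11 (d : ℕ) (hd : 1 ≤ d) (P : Matrix (Fin d) (Fin d) ℝ)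
    (hPnonneg : ∀ i j, 0 ≤ P i j)
    (hProw : ∀ i, ∑ j, P i j = 1)
    (hPcol : ∀ j, ∑ i, P i j = 1)
    (l : Fin d → ℝ) (hl : Antitone l) :
    (∑ i, l i * l i.rev) ≤ (∑ i, ∑ j, l i * P i j * l j) ∧
    (∑ i, ∑ j, l i * P i j * l j) ≤ ∑ i, (l i) ^ 2 := by
  obtain ⟨w, hw, hw_sum, h_form⟩ := exists_weights_sum_mul_of_mem_doublyStochastic
    (mem_doublyStochastic_iff_sum.2 ⟨hPnonneg, hProw, hPcol⟩) l l
  rw [h_form]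
  constructor
  · have h_anti : Antivary l fun i => l i.rev :=
      hl.antivary fun _ _ hij => hl (Fin.rev_le_rev.2 hij)
    calc ∑ i, l i * l i.rev = ∑ σ, w σ * ∑ i, l i * l i.rev := by
          rw [← Finset.sum_mul, hw_sum, one_mul]
      _ ≤ ∑ σ, w σ * ∑ i, l i * l (σ i) := by
          refine Finset.sum_le_sum fun σ _ => mul_le_mul_of_nonneg_left ?_ (hw σ)
          simpa using h_anti.sum_mul_le_sum_mul_comp_perm (σ := σ.trans Fin.revPerm)
  · calc ∑ σ, w σ * ∑ i, l i * l (σ i) ≤ ∑ σ, w σ * ∑ i, l i ^ 2 := by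
          refine Finset.sum_le_sum fun σ _ => mul_le_mul_of_nonneg_left ?_ (hw σ)
          simpa only [sq] using (hl.monovary hl).sum_mul_comp_perm_le_sum_mul (σ := σ)
      _ = ∑ i, l i ^ 2 := by rw [← Finset.sum_mul, hw_sum, one_mul]
end

section
/- Let K ≥ 1 and let x₀ < x₁ < ⋯ < x_{K−1} be strictly increasing real numbers. Then there exist w : Fin K → ℝ and b : Fin K → ℝ such that for every k ∈ {0, …, K−1} and every j ≠ k, w_k·x_k + b_k > w_j·x_k + b_j. In other words, K pairwise-distinct feature values can be classified into K distinct labels by a one-layer affine network followed by argmax: the k-th affine function is the unique maximizer at the point x_k. (This is the key separation step showing that VSQL with softmax readout can distinguish K classes whenever some shadow feature takes K distinct values, one per class.) -/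
theorem stmt_16 (K : ℕ) (hK : 1 ≤ K) (x : Fin K → ℝ) (hx : StrictMono x) :
    ∃ w b : Fin K → ℝ, ∀ k j : Fin K, j ≠ k →
      w j * x k + b j < w k * x k + b k := by
  refine ⟨fun i => 2 * x i, fun i => -x i ^ 2, fun k j hjk => ?_⟩
  have hne : x j - x k ≠ 0 := sub_ne_zero.mpr (hx.injective.ne hjk)
  have hpos : 0 < (x j - x k) ^ 2 := by positivity
  dsimp only
  linarith
end
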